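/- Let (A, m) be a regular local Noetherian ring of dimension r with residue field k = A/m, and let x₁,…,x_r ∈ m be elements whose images form a basis of the k-vector space m/m². Then for every j ∈ ℕ, the images in m^j/m^{j+1} of the monomials x₁^{i₁}⋯x_r^{i_r} of total degree i₁+⋯+i_r = j form a basis of the k-vector space m^j/m^{j+1}. -/

import Mathlib

open IsLocalRing

/-- Positive weights on `r` variables which separate the monomials of degree `j` and give each of
them a weight smaller than that of any monomial of degree `j + 1`. -/
theorem exists_separating_weights (r j : ℕ) : ∃ (b : Fin r → ℕ) (N : ℕ), 0 < N ∧ (∀ t, N ≤ b t) ∧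
    (∀ i : Fin r → ℕ, ∑ t, i t = j → ∑ t, i t * b t < (j + 1) * N) ∧
    Set.InjOn (fun i : Fin r → ℕ => ∑ t, i t * b t) {i | ∑ t, i t = j} := by
  have hsum (i : Fin r → ℕ) (hi : ∑ t, i t = j) :
      ∑ t, i t * (j * (j + 2) ^ r + 1 + (j + 2) ^ (t : ℕ)) =
        j * (j * (j + 2) ^ r + 1) + ∑ t, i t * (j + 2) ^ (t : ℕ) := by
    simp only [mul_add, Finset.sum_add_distrib, ← Finset.sum_mul, hi]
  refine ⟨fun t => j * (j + 2) ^ r + 1 + (j + 2) ^ (t : ℕ), j * (j + 2) ^ r + 1, by positivity,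
    fun t => Nat.le_add_right _ _, fun i hi => ?_, fun i hi i' hi' h => ?_⟩
  · have hle : ∑ t, i t * (j + 2) ^ (t : ℕ) ≤ j * (j + 2) ^ r := by
      rw [← hi, Finset.sum_mul, hi]
      refine Finset.sum_le_sum fun t _ => Nat.mul_le_mul_left _ ?_
      exact Nat.pow_le_pow_right (by omega) t.2.le
    rw [hsum i hi, add_one_mul]
    omega
  · simp only [Set.mem_ofPred_eq] at hi hi'
    have hlt (l : Fin r → ℕ) (hl : ∑ t, l t = j) : ∀ d ∈ List.ofFn l, d < j + 2 := by
      intro d hd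
      obtain ⟨t, rfl⟩ := (List.mem_ofFn' l d).1 hd
      have := Finset.single_le_sum (fun s _ => Nat.zero_le (l s)) (Finset.mem_univ t)
      omega
    have hdigits : ∑ t, i t * (j + 2) ^ (t : ℕ) = ∑ t, i' t * (j + 2) ^ (t : ℕ) := by
      simpa only [hsum i hi, hsum i' hi', add_right_inj] using h
    refine List.ofFn_inj.mp (Nat.ofDigits_inj_of_len_eq (b := j + 2) (by omega) (by simp)
      (hlt i hi) (hlt i' hi') ?_)
    simpa only [Nat.ofDigits_eq_sum_mapIdx, List.mapIdx_eq_ofFn, List.get_ofFn, List.length_ofFn,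
      Fin.val_cast, List.sum_ofFn] using! hdigits

/-- Every prime of a local ring is the support of a valuation centered at the maximal ideal. -/
theorem IsLocalRing.exists_valuation_supp_eq.{u} {A : Type u} [CommRing A] [IsLocalRing A]
    (p : Ideal A) [p.IsPrime] :
    ∃ (Γ : Type u) (_ : LinearOrderedCommGroupWithZero Γ) (v : Valuation A Γ),
      v.supp = p ∧ (∀ a, v a ≤ 1) ∧ ∀ a ∈ maximalIdeal A, v a < 1 := by
  let f : A →+* FractionRing (A ⧸ p) := (algebraMap (A ⧸ p) _).comp (Ideal.Quotient.mk p)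
  obtain ⟨V, h, hloc⟩ := IsLocalRing.exists_factor_valuationRing f
  refine ⟨_, inferInstance, V.valuation.comap f, ?_, fun a => ?_, fun a ha => ?_⟩
  · ext a
    simp [Valuation.mem_supp_iff, f, Ideal.Quotient.eq_zero_iff_mem]
  · exact V.valuation_le_one ⟨f a, h a⟩
  · refine (V.valuation_lt_one_iff ⟨f a, h a⟩).1 ?_
    rw [mem_maximalIdeal, mem_nonunits_iff] at ha ⊢
    exact fun hu => ha (hloc.map_nonunit a hu)

/-- If a valuation satisfies `v y ^ a ≤ g` on a generating set of an ideal, then it satisfies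
`v z ^ a ≤ g ^ n` on the `n`-th power of the ideal. -/
theorem Valuation.pow_le_pow_of_mem_span_pow {A Γ : Type*} [CommRing A]
    [LinearOrderedCommGroupWithZero Γ] (v : Valuation A Γ) (hv : ∀ z, v z ≤ 1) {s : Set A}
    {a : ℕ} (ha : a ≠ 0) {g : Γ} (hs : ∀ y ∈ s, v y ^ a ≤ g) (n : ℕ) {z : A}
    (hz : z ∈ Ideal.span s ^ n) :
    v z ^ a ≤ g ^ n := by
  have hadd {h : Γ} {y z : A} (hy : v y ^ a ≤ h) (hz : v z ^ a ≤ h) : v (y + z) ^ a ≤ h := by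
    rcases v.map_add' y z with hle | hle
    · exact (pow_le_pow_left₀ zero_le hle a).trans hy
    · exact (pow_le_pow_left₀ zero_le hle a).trans hz
  have hmul {h : Γ} (c : A) {y : A} (hy : v y ^ a ≤ h) : v (c * y) ^ a ≤ h := by
    rw [map_mul, mul_pow]
    exact (mul_le_of_le_one_left' (pow_le_one' (hv c) a)).trans hy
  induction n generalizing z with
  | zero => simpa using pow_le_one' (hv z) a
  | succ n ih =>
    rw [pow_succ] at hz
    refine Submodule.mul_induction_on hz (fun y hy w hw => ?_) fun y w => hadd
    rw [map_mul, mul_pow, pow_succ]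
    refine mul_le_mul' (ih hy) ?_
    refine Submodule.span_induction hs ?_ (fun _ _ _ _ => hadd) (fun c _ _ => hmul c) hw
    simp [ha]

/-- A system of parameters `x` of a local ring stays nonzero modulo some prime containing the
`x t ^ b s - x s ^ b t` for a fixed index `s`. -/
theorem IsLocalRing.exists_isPrime_pow_sub_pow_mem {A : Type*} [CommRing A] [IsNoetherianRing A]
    [IsLocalRing A] {r : ℕ} (hdim : ringKrullDim A = r) (x : Fin r → A)
    (hx : Ideal.span (Set.range x) = maximalIdeal A) (b : Fin r → ℕ) (hb : ∀ t, b t ≠ 0)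
    (s : Fin r) :
    ∃ p : Ideal A, p.IsPrime ∧ (∀ t, x t ^ b s - x s ^ b t ∈ p) ∧ x s ∉ p := by
  have hxm (t) : x t ∈ maximalIdeal A := hx ▸ Ideal.subset_span ⟨t, rfl⟩
  let T : Set A := (fun t => x t ^ b s - x s ^ b t) '' {s}ᶜ
  have hcard : T.ncard < r := by
    refine (Set.ncard_image_le (Set.toFinite _)).trans_lt ?_
    have := s.pos
    rw [Set.ncard_compl]
    simp
    omega
  have hTm : Ideal.span T ≤ maximalIdeal A := by
    rw [Ideal.span_le]
    rintro _ ⟨t, -, rfl⟩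
    exact sub_mem (Ideal.pow_mem_of_mem _ (hxm t) _ (Nat.pos_of_ne_zero (hb s)))
      (Ideal.pow_mem_of_mem _ (hxm s) _ (Nat.pos_of_ne_zero (hb t)))
  have hnot : maximalIdeal A ∉ (Ideal.span T).minimalPrimes := by
    intro hmin
    have hle := Ideal.height_le_card_of_mem_minimalPrimes_span (Set.toFinite T) hmin
    have hheight := maximalIdeal_height_eq_ringKrullDim (R := A)
    rw [hdim] at hheight
    have hr : (maximalIdeal A).height = (r : ℕ∞) := by exact_mod_cast hheight
    rw [hr, Nat.cast_le] at hle
    omega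
  obtain ⟨p, hp, hpm⟩ := Ideal.exists_minimalPrimes_le hTm
  have hprime : p.IsPrime := hp.isPrime
  have hmem (t) : x t ^ b s - x s ^ b t ∈ p := by
    by_cases hts : t = s
    · simp [hts]
    · exact hp.1.2 (Ideal.subset_span ⟨t, hts, rfl⟩)
  refine ⟨p, hprime, hmem, fun hs => hnot ?_⟩
  have hmp : maximalIdeal A ≤ p := by
    rw [← hx, Ideal.span_le]
    rintro _ ⟨t, rfl⟩
    refine hprime.mem_of_pow_mem (b s) ?_
    have := p.add_mem (hmem t) (Ideal.pow_mem_of_mem _ hs _ (Nat.pos_of_ne_zero (hb t)))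
    simpa using this
  rwa [le_antisymm hmp hpm]

/-- Elements of the `j`-th power of the ideal generated by `x` are combinations of the monomials
of degree `j` in `x`. -/
theorem Ideal.exists_sum_monomials_of_mem_span_pow {A : Type*} [CommRing A] {r : ℕ}
    (x : Fin r → A) (j : ℕ) {z : A} (hz : z ∈ Ideal.span (Set.range x) ^ j) :
    ∃ c : (Fin r → ℕ) →₀ A, (∀ i ∈ c.support, ∑ t, i t = j) ∧
      c.sum (fun i a => a * ∏ t, x t ^ i t) = z := by
  classical
  obtain ⟨p, hp, rfl⟩ := (Ideal.mem_span_pow_iff_exists_isHomogeneous x z).1 hz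
  refine ⟨Finsupp.onFinset (p.support.image (⇑))
    (fun i => p.coeff (Finsupp.equivFunOnFinite.symm i)) fun i hi => ?_, fun i hi => ?_, ?_⟩
  · exact Finset.mem_image.2 ⟨_, MvPolynomial.mem_support_iff.2 hi, rfl⟩
  · rw [Finsupp.mem_support_onFinset] at hi
    simpa [Finsupp.weight_apply, Finsupp.sum_fintype] using hp hi
  · rw [Finsupp.onFinset_sum _ (by simp), Finset.sum_image (by simp), MvPolynomial.eval_eq']
    refine Finset.sum_congr rfl fun d _ => ?_
    rw [Finsupp.equivFunOnFinite_symm_coe]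

/-- In a regular local ring, a homogeneous form of degree `j` in a regular system of parameters
whose value lies in `𝔪 ^ (j + 1)` has all its coefficients in `𝔪`. -/
theorem IsLocalRing.coeff_mem_maximalIdeal_of_sum_monomials_mem {A : Type*} [CommRing A]
    [IsNoetherianRing A] [IsLocalRing A] {r : ℕ} (hdim : ringKrullDim A = r) (x : Fin r → A)
    (hx : Ideal.span (Set.range x) = maximalIdeal A) (j : ℕ) (c : (Fin r → ℕ) →₀ A)
    (hc : ∀ i ∈ c.support, ∑ t, i t = j)
    (hmem : c.sum (fun i a => a * ∏ t, x t ^ i t) ∈ maximalIdeal A ^ (j + 1)) (i : Fin r → ℕ) :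
    c i ∈ maximalIdeal A := by
  classical
  by_contra hi
  have hsupp {l} (hl : c l ∉ maximalIdeal A) : l ∈ c.support :=
    Finsupp.mem_support_iff.2 fun h => hl (h ▸ zero_mem _)
  obtain rfl | hr := r.eq_zero_or_pos
  · have hj : j = 0 := by simpa using (hc i (hsupp hi)).symm
    subst hj
    rw [Finsupp.sum_of_support_subset c (s := {i})
      (fun l _ => Finset.mem_singleton.2 (Subsingleton.elim l i)) _ (by simp)] at hmem
    exact hi (by simpa using hmem)
  obtain ⟨b, N, hN, hNb, hblt, hbinj⟩ := exists_separating_weights r j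
  have hb (t) : b t ≠ 0 := (hN.trans_le (hNb t)).ne'
  let s : Fin r := ⟨0, hr⟩
  obtain ⟨p, hp, hpmem, hps⟩ := exists_isPrime_pow_sub_pow_mem hdim x hx b hb s
  obtain ⟨Γ, _, v, hvp, hv1, hvm⟩ := exists_valuation_supp_eq p
  have hs0 : 0 < v (x s) := by
    rw [zero_lt_iff, Ne, ← Valuation.mem_supp_iff, hvp]
    exact hps
  have hs1 : v (x s) < 1 := hvm _ (hx ▸ Ideal.subset_span ⟨s, rfl⟩)
  have hvx (t) : v (x t) ^ b s = v (x s) ^ b t := by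
    have h := v.map_add_supp (x s ^ b t) (hvp.symm ▸ hpmem t)
    rw [← map_pow, ← map_pow, ← h]
    congr 1
    ring
  have hmono (i : Fin r → ℕ) : v (∏ t, x t ^ i t) ^ b s = v (x s) ^ ∑ t, i t * b t := by
    simp only [map_prod, map_pow, ← Finset.prod_pow, ← Finset.prod_pow_eq_pow_sum]
    refine Finset.prod_congr rfl fun t _ => ?_
    rw [pow_right_comm, hvx, ← pow_mul, mul_comm]
  have hpow (n : ℕ) {z : A} (hz : z ∈ maximalIdeal A ^ n) : v z ^ b s ≤ v (x s) ^ (N * n) := by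
    rw [pow_mul]
    refine v.pow_le_pow_of_mem_span_pow hv1 (s := Set.range x) (hb s) ?_ n (hx.symm ▸ hz)
    rintro _ ⟨t, rfl⟩
    rw [hvx]
    exact pow_le_pow_right_of_le_one' hs1.le (hNb t)
  have hunit {a : A} (ha : a ∉ maximalIdeal A) : v a = 1 := by
    obtain ⟨u, hu⟩ := (notMem_maximalIdeal.1 ha).exists_right_inv
    refine le_antisymm (hv1 a) ?_
    calc 1 = v a * v u := by rw [← map_mul, hu, map_one]
      _ ≤ v a := mul_le_of_le_one_right' (hv1 u)
  obtain ⟨l, hl, hmin⟩ := (c.support.filter fun l => c l ∉ maximalIdeal A).exists_min_image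
    (fun l => ∑ t, l t * b t) ⟨i, Finset.mem_filter.2 ⟨hsupp hi, hi⟩⟩
  obtain ⟨hlc, hlu⟩ := Finset.mem_filter.1 hl
  have hvl : v (c l * ∏ t, x t ^ l t) ^ b s = v (x s) ^ ∑ t, l t * b t := by
    rw [map_mul, hunit hlu, one_mul, hmono]
  have hvsum : v (c.sum fun i a => a * ∏ t, x t ^ i t) = v (c l * ∏ t, x t ^ l t) := by
    refine v.map_sum_eq_of_lt hlc fun i hi => ?_
    obtain ⟨hic, hil⟩ := Finset.mem_sdiff.1 hi
    refine lt_of_pow_lt_pow_left₀ (b s) zero_le ?_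
    rw [hvl, map_mul, mul_pow, hmono]
    by_cases hci : c i ∈ maximalIdeal A
    · have hwl := hblt l (hc l hlc)
      have hwi : j * N ≤ ∑ t, i t * b t := by
        rw [← hc i hic, Finset.sum_mul]
        exact Finset.sum_le_sum fun t _ => Nat.mul_le_mul_left _ (hNb t)
      calc v (c i) ^ b s * v (x s) ^ ∑ t, i t * b t
          ≤ v (x s) ^ N * v (x s) ^ ∑ t, i t * b t := by
            refine mul_le_mul_left ?_ _
            simpa only [mul_one] using hpow 1 (by rwa [pow_one])
        _ = v (x s) ^ (N + ∑ t, i t * b t) := (pow_add _ _ _).symm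
        _ < v (x s) ^ ∑ t, l t * b t :=
            pow_lt_pow_right_of_lt_one₀ hs0 hs1 (by rw [add_one_mul] at hwl; omega)
    · rw [hunit hci, one_pow, one_mul]
      refine pow_lt_pow_right_of_lt_one₀ hs0 hs1 ?_
      refine lt_of_le_of_ne (hmin i (Finset.mem_filter.2 ⟨hic, hci⟩)) fun h => hil ?_
      exact Finset.mem_singleton.2 (hbinj (hc i hic) (hc l hlc) h.symm)
  have hle := hpow (j + 1) hmem
  rw [hvsum, hvl, mul_comm] at hle
  exact hle.not_gt (pow_lt_pow_right_of_lt_one₀ hs0 hs1 (hblt l (hc l hlc)))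

/-- Let `(A, 𝔪)` be a regular local Noetherian ring of dimension `r`
(regularity is encoded by the hypothesis that the `r` elements `x t` map to a basis of
`𝔪/𝔪²`, together with `ringKrullDim A = r`).  Then for every `j`, the images of the
monomials of total degree `j` in the `x t` form a basis of the `A/𝔪`-vector space
`𝔪^j/𝔪^(j+1)`: they span it, and any `A`-linear combination of them lying in `𝔪^(j+1)`
has all its coefficients in `𝔪`. -/
theorem stmt_0 {A : Type*} [CommRing A] [IsNoetherianRing A] [IsLocalRing A]
    (r : ℕ) (hdim : ringKrullDim A = r)
    (x : Fin r → A) (hxm : ∀ t, x t ∈ maximalIdeal A)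
    (hspan : ∀ z ∈ maximalIdeal A, ∃ c : Fin r → A,
      z - ∑ t, c t * x t ∈ (maximalIdeal A) ^ 2)
    (hindep : ∀ c : Fin r → A, (∑ t, c t * x t) ∈ (maximalIdeal A) ^ 2 →
      ∀ t, c t ∈ maximalIdeal A)
    (j : ℕ) :
    (∀ z ∈ (maximalIdeal A) ^ j, ∃ c : (Fin r → ℕ) →₀ A,
        (∀ i ∈ c.support, ∑ t, i t = j) ∧
        z - c.sum (fun i a => a * ∏ t, x t ^ i t) ∈ (maximalIdeal A) ^ (j + 1)) ∧
      (∀ c : (Fin r → ℕ) →₀ A, (∀ i ∈ c.support, ∑ t, i t = j) →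
        c.sum (fun i a => a * ∏ t, x t ^ i t) ∈ (maximalIdeal A) ^ (j + 1) →
        ∀ i : Fin r → ℕ, (∑ t, i t = j) → c i ∈ maximalIdeal A) := by
  have hx : Ideal.span (Set.range x) = maximalIdeal A := by
    refine le_antisymm (Ideal.span_le.2 (Set.range_subset_iff.2 hxm)) ?_
    refine Submodule.le_of_le_smul_of_le_jacobson_bot (IsNoetherian.noetherian _)
      (maximalIdeal_le_jacobson ⊥) fun z hz => ?_
    obtain ⟨c, hc⟩ := hspan z hz
    rw [← add_sub_cancel (∑ t, c t * x t) z]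
    refine Submodule.add_mem_sup (sum_mem fun t _ => ?_) (by rwa [smul_eq_mul, ← pow_two])
    exact Ideal.mul_mem_left _ _ (Ideal.subset_span ⟨t, rfl⟩)
  refine ⟨fun z hz => ?_, fun c hc hmem i _ =>
    coeff_mem_maximalIdeal_of_sum_monomials_mem hdim x hx j c hc hmem i⟩
  obtain ⟨c, hc, rfl⟩ := Ideal.exists_sum_monomials_of_mem_span_pow x j (hx.symm ▸ hz)
  exact ⟨c, hc, by simp⟩
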